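/- Let G be a non-elementary hyperbolic group. The metric space (𝒟(G), Δ) is unbounded: there is a sequence of metric structures ρ_n with Δ(ρ_n, ρ_1) → ∞. -/

import Mathlib

open Filter Set MeasureTheory Topology

noncomputable section

variable {X : Type*}

/-- The Gromov product `(x|y)_w` with respect to `d`. -/
def gp (d : X → X → ℝ) (w x y : X) : ℝ := (d x w + d y w - d x y) / 2

/-- `d` is a pseudometric. -/
def IsPseudometric (d : X → X → ℝ) : Prop :=
  (∀ x, d x x = 0) ∧ (∀ x y, d x y = d y x) ∧ (∀ x y z, d x z ≤ d x y + d y z)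

/-- `d` is `δ`-hyperbolic: the four-point Gromov product condition. -/
def GromovHyperbolic (d : X → X → ℝ) (δ : ℝ) : Prop :=
  ∀ x y z w, min (gp d w x y) (gp d w y z) - δ ≤ gp d w x z

/-- `d` is `α`-rough geodesic: any two points are joined by an `α`-rough geodesic. -/
def RoughGeodesic (d : X → X → ℝ) (α : ℝ) : Prop :=
  ∀ x y : X, ∃ (n : ℕ) (γ : ℕ → X), γ 0 = x ∧ γ n = y ∧
    ∀ i j : ℕ, i ≤ n → j ≤ n →
      |(i : ℝ) - (j : ℝ)| - α ≤ d (γ i) (γ j) ∧ d (γ i) (γ j) ≤ |(i : ℝ) - (j : ℝ)| + α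

variable {G : Type*} [Group G]

/-- Left invariance of a pseudometric on a group. -/
def LeftInvariant (d : G → G → ℝ) : Prop := ∀ g x y : G, d (g * x) (g * y) = d x y

/-- Word norm with respect to a subset `S`. -/
def wordNorm (S : Set G) (w : G) : ℕ :=
  sInf {k : ℕ | ∃ f : Fin k → G, (∀ i, f i ∈ S) ∧ (List.ofFn f).prod = w}

/-- Word metric with respect to a subset `S`. -/
def wordDist (S : Set G) (x y : G) : ℝ := (wordNorm S (x⁻¹ * y) : ℝ)

/-- `S` is a symmetric generating set. -/
def GenSymm (S : Set G) : Prop := (∀ s ∈ S, s⁻¹ ∈ S) ∧ Subgroup.closure S = ⊤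

/-- `d'` is quasi-isometric to `d` (via the identity map of `G`). -/
def QIsometric (d d' : G → G → ℝ) : Prop :=
  ∃ l1 l2 e : ℝ, 0 < l1 ∧ 0 < l2 ∧ 0 ≤ e ∧
    ∀ x y : G, d x y / l1 - e ≤ d' x y ∧ d' x y ≤ l2 * d x y + e

/-- Membership in `D(G)`: a left-invariant hyperbolic pseudometric on `G`
quasi-isometric to a word metric w.r.t. a finite symmetric generating set. -/
def InD (d : G → G → ℝ) : Prop :=
  IsPseudometric d ∧ LeftInvariant d ∧ (∃ δ ≥ (0 : ℝ), GromovHyperbolic d δ) ∧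
    ∃ S : Finset G, GenSymm (S : Set G) ∧ QIsometric (wordDist (S : Set G)) d

/-- `G` is a hyperbolic group: some word metric is Gromov hyperbolic. -/
def IsHyperbolicGroup (G : Type*) [Group G] : Prop :=
  ∃ S : Finset G, GenSymm (S : Set G) ∧ ∃ δ ≥ (0 : ℝ), GromovHyperbolic (wordDist (S : Set G)) δ

/-- `G` is non-elementary: it is not virtually abelian. -/
def NonElementary (G : Type*) [Group G] : Prop :=
  ¬ ∃ H : Subgroup G, H.FiniteIndex ∧ ∀ a ∈ H, ∀ b ∈ H, a * b = b * a

/-- Translation length `ℓ_d(x) = lim_n d(x^n,1)/n`; by Fekete's subadditivity lemma the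
limit exists and equals the infimum of `d(x^n,1)/n` over `n ≥ 1`. -/
def tlen (d : G → G → ℝ) (x : G) : ℝ :=
  sInf {r : ℝ | ∃ n : ℕ, r = d (x ^ (n + 1)) 1 / (n + 1)}

/-- Dilation `Dil(d,d') = sup_x ℓ_d(x)/ℓ_{d'}(x)` over infinite-order elements. -/
def Dil (d d' : G → G → ℝ) : ℝ :=
  sSup {r : ℝ | ∃ x : G, ¬ IsOfFinOrder x ∧ r = tlen d x / tlen d' x}

/-- Critical exponent `h(d) = lim_n log|B_d(n)|/n` (the limit exists, so it equals
the limsup used here). -/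
def hCrit (d : G → G → ℝ) : ℝ :=
  Filter.limsup (fun n : ℕ => Real.log (Set.ncard {x : G | d x 1 ≤ (n : ℝ)}) / (n : ℝ)) atTop

/-- `Λ(d1,d2)`: the infimum of `λ1·λ2` over quasi-isometry constants between `d1,d2`. -/
def Lam (d1 d2 : G → G → ℝ) : ℝ :=
  sInf {l : ℝ | ∃ l1 l2 A : ℝ, 0 < l1 ∧ 0 < l2 ∧ 0 ≤ A ∧ l = l1 * l2 ∧
    ∀ x y : G, d2 x y / l1 - A ≤ d1 x y ∧ d1 x y ≤ l2 * d2 x y + A}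

/-- Rough similarity of pseudometrics: `|d − k·d'| ≤ A` for some `k > 0`, `A ≥ 0`. -/
def RSim (d d' : G → G → ℝ) : Prop :=
  ∃ k A : ℝ, 0 < k ∧ 0 ≤ A ∧ ∀ x y : G, |d x y - k * d' x y| ≤ A

set_option linter.unusedSectionVars false in
theorem rsim_refl (d : G → G → ℝ) : RSim d d :=
  ⟨1, 0, one_pos, le_refl 0, fun x y => by simp⟩

set_option linter.unusedSectionVars false in
theorem rsim_symm {d d' : G → G → ℝ} : RSim d d' → RSim d' d := by
  rintro ⟨k, A, hk, hA, h⟩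
  refine ⟨k⁻¹, k⁻¹ * A, inv_pos.2 hk, mul_nonneg (inv_pos.2 hk).le hA, fun x y => ?_⟩
  have hk0 : k ≠ 0 := ne_of_gt hk
  have h1 : d' x y - k⁻¹ * d x y = -(k⁻¹ * (d x y - k * d' x y)) := by
    field_simp
    ring
  rw [h1, abs_neg, abs_mul, abs_of_pos (inv_pos.2 hk)]
  exact mul_le_mul_of_nonneg_left (h x y) (inv_pos.2 hk).le

set_option linter.unusedSectionVars false in
theorem rsim_trans {d1 d2 d3 : G → G → ℝ} : RSim d1 d2 → RSim d2 d3 → RSim d1 d3 := by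
  rintro ⟨k1, A1, hk1, hA1, h1⟩ ⟨k2, A2, hk2, hA2, h2⟩
  refine ⟨k1 * k2, A1 + k1 * A2, mul_pos hk1 hk2, by positivity, fun x y => ?_⟩
  have h3 : |k1 * d2 x y - k1 * k2 * d3 x y| = k1 * |d2 x y - k2 * d3 x y| := by
    rw [show k1 * d2 x y - k1 * k2 * d3 x y = k1 * (d2 x y - k2 * d3 x y) by ring,
      abs_mul, abs_of_pos hk1]
  calc |d1 x y - k1 * k2 * d3 x y|
      ≤ |d1 x y - k1 * d2 x y| + |k1 * d2 x y - k1 * k2 * d3 x y| :=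
        abs_sub_le _ _ _
    _ ≤ A1 + k1 * A2 := by
        rw [h3]
        exact add_le_add (h1 x y) (mul_le_mul_of_nonneg_left (h2 x y) hk1.le)

/-- Elements of `D(G)`. -/
def DSub (G : Type*) [Group G] : Type _ := {d : G → G → ℝ // InD d}

/-- Rough similarity as a setoid on `D(G)`. -/
def rsSetoid (G : Type*) [Group G] : Setoid (DSub G) :=
  ⟨fun d d' => RSim d.1 d'.1,
    ⟨fun d => rsim_refl d.1, fun h => rsim_symm h, fun h h' => rsim_trans h h'⟩⟩

/-- The space `𝒟(G)` of metric structures on `G`. -/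
def MetricStructures (G : Type*) [Group G] : Type _ := Quotient (rsSetoid G)

/-- The distance `Δ = log Λ` on `𝒟(G)` (the value of `Λ` does not depend on the
choice of representatives). -/
def Delta (ρ1 ρ2 : MetricStructures G) : ℝ :=
  Real.log (sInf {l : ℝ | ∃ d1 d2 : DSub G,
    Quotient.mk (rsSetoid G) d1 = ρ1 ∧ Quotient.mk (rsSetoid G) d2 = ρ2 ∧ l = Lam d1.1 d2.1})


/-! ### Part 1: coarse geometry of pseudometrics -/

/-- discrete geodesicity -/
def Geod (d : X → X → ℝ) : Prop :=
  ∀ x y : X, ∃ (n : ℕ) (γ : ℕ → X), γ 0 = x ∧ γ n = y ∧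
    ∀ i j : ℕ, i ≤ j → j ≤ n → d (γ i) (γ j) = (j : ℝ) - (i : ℝ)

theorem psm_nonneg {d : X → X → ℝ} (hd : IsPseudometric d) (x y : X) : 0 ≤ d x y := by
  have h1 := hd.2.2 x y x
  rw [hd.1, hd.2.1 y x] at h1
  linarith

theorem gp_nonneg {d : X → X → ℝ} (hd : IsPseudometric d) (w x y : X) : 0 ≤ gp d w x y := by
  have h1 := hd.2.2 x w y
  rw [hd.2.1 w y] at h1
  unfold gp
  linarith

theorem gp_comm {d : X → X → ℝ} (hd : IsPseudometric d) (w x y : X) :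
    gp d w x y = gp d w y x := by
  unfold gp
  rw [hd.2.1 x y]
  ring

theorem gp_le_gp_add {d : X → X → ℝ} (hd : IsPseudometric d) (w p x y : X) :
    gp d w x y ≤ gp d p x y + d w p := by
  have h1 := hd.2.2 x p w
  have h2 := hd.2.2 y p w
  rw [hd.2.1 p w] at h1 h2
  unfold gp
  linarith

/-- logarithmic divergence of paths -/
theorem log_path {d : X → X → ℝ} (hd : IsPseudometric d) {δ M : ℝ}
    (hh : GromovHyperbolic d δ) (p : X) (k : ℕ) :
    ∀ (m : ℕ) (q : ℕ → X), m ≤ 2 ^ k → (∀ i, i < m → d (q i) (q (i + 1)) ≤ M) →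
      0 ≤ M → ∃ i ≤ m, d p (q i) ≤ gp d p (q 0) (q m) + M + k * δ := by
  induction k with
  | zero =>
    intro m q hm hq hM
    refine ⟨0, Nat.zero_le _, ?_⟩
    have hm' : m = 0 ∨ m = 1 := by
      simp at hm; omega
    rcases hm' with rfl | rfl
    · simp only [gp, hd.1, hd.2.1 p (q 0), Nat.cast_zero]
      linarith
    · have h1 := hq 0 (by norm_num)
      have h2 := hd.2.2 (q 0) (q 1) p
      have h3 := hd.2.2 (q 1) (q 0) p
      simp only [zero_add] at h1
      rw [hd.2.1 (q 1) (q 0)] at h3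
      simp only [gp, hd.2.1 p (q 0), Nat.cast_zero]
      linarith
  | succ k ih =>
    intro m q hm hq hM
    have key := hh (q 0) (q (min m (2 ^ k))) (q m) p
    rcases min_le_iff.1 (le_of_eq (rfl : min (gp d p (q 0) (q (min m (2 ^ k))))
      (gp d p (q (min m (2 ^ k))) (q m)) = _)) with h | h
    · obtain ⟨i, hi, hi'⟩ := ih (min m (2 ^ k)) q (min_le_right _ _)
        (fun i hi => hq i (lt_of_lt_of_le hi (min_le_left _ _))) hM
      refine ⟨i, hi.trans (min_le_left _ _), ?_⟩
      push_cast
      linarith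
    · obtain ⟨i, hi, hi'⟩ := ih (m - min m (2 ^ k)) (fun i => q (min m (2 ^ k) + i))
        (by rw [pow_succ] at hm; omega)
        (fun i hi => by
          have := hq (min m (2 ^ k) + i) (by omega)
          simpa [add_assoc] using this) hM
      refine ⟨min m (2 ^ k) + i, by omega, ?_⟩
      have e : min m (2 ^ k) + (m - min m (2 ^ k)) = m := by omega
      simp only [e, add_zero] at hi'
      push_cast
      linarith

/-- a logarithmic self-bound is a bound -/
theorem log_bound (A δ : ℝ) : ∃ D0 : ℝ, 0 ≤ D0 ∧ ∀ D : ℝ, 0 ≤ D →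
    (∀ k : ℕ, 6 * D ≤ 2 ^ k → D ≤ A + k * δ) → D ≤ D0 := by
  have ht : Tendsto (fun k : ℕ => (k : ℝ) ^ 1 / (2 : ℝ) ^ k) atTop (𝓝 0) :=
    tendsto_pow_const_div_const_pow_of_one_lt 1 (by norm_num)
  have ht2 : Tendsto (fun k : ℕ => ((1 : ℝ) / 2) ^ k) atTop (𝓝 0) :=
    tendsto_pow_atTop_nhds_zero_of_lt_one (by norm_num) (by norm_num)
  have ht3 : Tendsto (fun k : ℕ => A * ((1 : ℝ) / 2) ^ k + δ * ((k : ℝ) ^ 1 / (2 : ℝ) ^ k))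
      atTop (𝓝 (A * 0 + δ * 0)) := (ht2.const_mul A).add (ht.const_mul δ)
  have hev : ∀ᶠ k : ℕ in atTop,
      A * ((1 : ℝ) / 2) ^ k + δ * ((k : ℝ) ^ 1 / (2 : ℝ) ^ k) < 1 / 12 :=
    ht3.eventually (gt_mem_nhds (by norm_num))
  obtain ⟨N, hN⟩ := eventually_atTop.1 hev
  refine ⟨2 ^ N, by positivity, fun D hD h => ?_⟩
  by_contra hlt
  push Not at hlt
  -- choose the least k with 6 D ≤ 2^k
  have hex : ∃ k : ℕ, 6 * D ≤ 2 ^ k := by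
    obtain ⟨k, hk⟩ := pow_unbounded_of_one_lt (6 * D) (by norm_num : (1 : ℝ) < 2)
    exact ⟨k, hk.le⟩
  classical
  set k := Nat.find hex with hk
  have hk1 : 6 * D ≤ 2 ^ k := Nat.find_spec hex
  have hNk : N ≤ k := by
    by_contra hc
    push Not at hc
    have : (2 : ℝ) ^ k ≤ 2 ^ N := pow_le_pow_right₀ (by norm_num) hc.le
    have : (0 : ℝ) < 2 ^ N := by positivity
    linarith
  have hk0 : k ≠ 0 := by
    intro h0
    rw [h0] at hk1
    have : (1 : ℝ) ≤ 2 ^ N := one_le_pow₀ (by norm_num)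
    norm_num at hk1
    linarith
  have hk2 : ¬ (6 * D ≤ 2 ^ (k - 1)) := Nat.find_min hex (by omega)
  push Not at hk2
  have e2 : (2 : ℝ) ^ k = 2 * 2 ^ (k - 1) := by
    rw [← pow_succ']
    congr 1
    omega
  have h3 := hN k hNk
  have h4 := h k hk1
  have hp : (0 : ℝ) < 2 ^ k := by positivity
  have h5 : A + k * δ < 2 ^ k / 12 := by
    have : (A * ((1 : ℝ) / 2) ^ k + δ * ((k : ℝ) ^ 1 / (2 : ℝ) ^ k)) * 2 ^ k = A + k * δ := by
      rw [div_pow, one_pow]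
      field_simp
    rw [← this]
    nlinarith
  linarith

/-- Morse lemma, first half. -/
theorem morse1 {d d' : X → X → ℝ} (hd : IsPseudometric d) {δ M : ℝ} (hδ : 0 ≤ δ)
    (hM : 0 ≤ M) (hh : GromovHyperbolic d δ)
    (hle : ∀ x y, d' x y ≤ d x y) (hge : ∀ x y, d x y ≤ M * d' x y) :
    ∃ D0 : ℝ, 0 ≤ D0 ∧ ∀ (n n' : ℕ) (σ γ : ℕ → X), σ 0 = γ 0 → σ n = γ n' →
      (∀ i j : ℕ, i ≤ j → j ≤ n → d (σ i) (σ j) = (j : ℝ) - (i : ℝ)) →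
      (∀ i j : ℕ, i ≤ j → j ≤ n' → d' (γ i) (γ j) = (j : ℝ) - (i : ℝ)) →
      ∀ t ≤ n, ∃ s ≤ n', d (σ t) (γ s) ≤ D0 := by
  obtain ⟨D0, hD0, hD⟩ := log_bound (M + 3 * δ + 2) δ
  refine ⟨D0 + 1, by linarith, fun n n' σ γ h0 hn hσ hγ => ?_⟩
  -- distance to γ
  have hmin : ∀ t : ℕ, ∃ s ∈ Finset.range (n' + 1), ∀ s' ∈ Finset.range (n' + 1),
      d (σ t) (γ s) ≤ d (σ t) (γ s') := fun t =>
    Finset.exists_min_image _ _ ⟨0, by simp⟩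
  choose s hs hsmin using hmin
  obtain ⟨t0, ht0, hmax⟩ := Finset.exists_max_image (Finset.range (n + 1))
    (fun t => d (σ t) (γ (s t))) ⟨0, by simp⟩
  simp only [Finset.mem_range, Nat.lt_succ_iff] at hs hsmin ht0 hmax
  suffices hS : d (σ t0) (γ (s t0)) ≤ D0 + 1 from
    fun t ht => ⟨s t, hs t, (hmax t ht).trans hS⟩
  set E := d (σ t0) (γ (s t0)) with hE
  have hE0 : 0 ≤ E := psm_nonneg hd _ _
  set D : ℕ := ⌊E⌋₊ with hDdef
  have hDE : (D : ℝ) ≤ E := Nat.floor_le hE0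
  have hED : E < D + 1 := Nat.lt_floor_add_one E
  set p := σ t0 with hp
  -- left point
  have hleft : ∃ a sa : ℕ, a ≤ t0 ∧ sa ≤ n' ∧ d (σ a) p ≤ 2 * D ∧ d (σ a) (γ sa) ≤ D + 1 ∧
      (D : ℝ) - 1 ≤ gp d p (σ a) (γ sa) := by
    by_cases hc : 2 * D ≤ t0
    · refine ⟨t0 - 2 * D, s (t0 - 2 * D), by omega, hs _, ?_, ?_, ?_⟩
      · rw [hp, hσ _ _ (by omega) ht0]; push_cast [hc]; linarith
      · exact (hmax _ (by omega)).trans hED.le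
      · have h1 : d (σ (t0 - 2 * D)) p = 2 * D := by
          rw [hp, hσ _ _ (by omega) ht0]; push_cast [hc]; ring
        have h2 := hsmin t0 (s (t0 - 2 * D)) (hs _)
        have h3 := hmax (t0 - 2 * D) (by omega)
        rw [hd.2.1] at h2
        unfold gp
        rw [hd.2.1 _ p] at h2
        rw [hd.2.1 (γ _) p]
        rw [← hp] at *
        have h4 : E ≤ d p (γ (s (t0 - 2 * D))) := by
          simpa [hE, hd.2.1] using h2
        linarith
    · refine ⟨0, 0, by omega, by omega, ?_, ?_, ?_⟩
      · rw [hp, hσ _ _ (by omega) ht0]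
        have : (t0 : ℝ) ≤ 2 * D := by exact_mod_cast (by omega : t0 ≤ 2 * D)
        simpa using this
      · rw [h0, hd.1]; positivity
      · have h2 := hsmin t0 0 (by omega)
        simp only [gp, h0, hd.1]
        rw [hd.2.1 (γ 0) p]
        linarith
  have hright : ∃ b sb : ℕ, t0 ≤ b ∧ b ≤ n ∧ sb ≤ n' ∧ d (σ b) p ≤ 2 * D ∧
      d (σ b) (γ sb) ≤ D + 1 ∧ (D : ℝ) - 1 ≤ gp d p (γ sb) (σ b) := by
    by_cases hc : t0 + 2 * D ≤ n
    · refine ⟨t0 + 2 * D, s (t0 + 2 * D), by omega, hc, hs _, ?_, ?_, ?_⟩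
      · rw [hd.2.1, hp, hσ _ _ (by omega) hc]; push_cast; linarith
      · exact (hmax _ (by omega)).trans hED.le
      · have h1 : d (σ (t0 + 2 * D)) p = 2 * D := by
          rw [hd.2.1, hp, hσ _ _ (by omega) hc]; push_cast; ring
        have h4 : E ≤ d p (γ (s (t0 + 2 * D))) := hsmin t0 (s (t0 + 2 * D)) (hs _)
        have h3 := hmax (t0 + 2 * D) (by omega)
        rw [gp_comm hd]
        unfold gp
        rw [hd.2.1 (γ _) p]
        linarith
    · refine ⟨n, n', by omega, le_refl _, le_refl _, ?_, ?_, ?_⟩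
      · rw [hd.2.1, hp, hσ _ _ ht0 (le_refl _)]
        have : (n : ℝ) ≤ t0 + 2 * D := by exact_mod_cast (by omega : n ≤ t0 + 2 * D)
        linarith
      · rw [hn, hd.1]; positivity
      · have h2 := hsmin t0 n' (le_refl _)
        simp only [gp, hn, hd.1]
        rw [hd.2.1 (γ n') p]
        linarith
  obtain ⟨a, sa, ha, hsa, ha1, ha2, ha3⟩ := hleft
  obtain ⟨b, sb, hb, hbn, hsb, hb1, hb2, hb3⟩ := hright
  have hg0 : gp d p (σ a) (σ b) = 0 := by
    unfold gp
    rw [hd.2.1 (σ b) p, hp, hσ _ _ ha ht0, hσ _ _ hb hbn, hσ _ _ (ha.trans hb) hbn]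
    ring
  -- the subpath of γ between sa and sb
  have hpath : ∀ k : ℕ, 6 * (D : ℝ) + 2 ≤ 2 ^ k →
      E - M - k * δ ≤ gp d p (γ sa) (γ sb) := by
    intro k hk
    have hstep : ∀ i, i < n' → d (γ i) (γ (i + 1)) ≤ M := by
      intro i hi
      refine (hge _ _).trans ?_
      rw [hγ _ _ (by omega) (by omega)]
      push_cast
      linarith
    have hdd : d (γ sa) (γ sb) ≤ 6 * D + 2 := by
      have h1 := hd.2.2 (γ sa) (σ a) (γ sb)
      have h2 := hd.2.2 (σ a) (σ b) (γ sb)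
      have h3 := hd.2.2 (σ a) p (σ b)
      rw [hd.2.1 p (σ b)] at h3
      rw [hd.2.1 (γ sa) (σ a)] at h1
      linarith
    rcases le_total sa sb with hab | hab
    · have hlen : ((sb - sa : ℕ) : ℝ) ≤ 2 ^ k := by
        push_cast [hab]
        rw [← hγ _ _ hab hsb]
        exact (hle _ _).trans (hdd.trans hk)
      obtain ⟨i, hi, hi'⟩ := log_path hd hh p k (sb - sa) (fun i => γ (sa + i))
        (by exact_mod_cast hlen) (fun i hi => hstep (sa + i) (by omega)) hM
      have e : sa + (sb - sa) = sb := by omega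
      simp only [e, add_zero] at hi'
      have h4 : E ≤ d p (γ (sa + i)) := hsmin t0 _ (by omega)
      linarith
    · have hlen : ((sa - sb : ℕ) : ℝ) ≤ 2 ^ k := by
        push_cast [hab]
        rw [← hγ _ _ hab hsa]
        refine (hle _ _).trans ?_
        rw [hd.2.1]
        exact hdd.trans hk
      obtain ⟨i, hi, hi'⟩ := log_path hd hh p k (sa - sb) (fun i => γ (sb + i))
        (by exact_mod_cast hlen) (fun i hi => hstep (sb + i) (by omega)) hM
      have e : sb + (sa - sb) = sa := by omega
      simp only [e, add_zero] at hi'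
      have h4 : E ≤ d p (γ (sb + i)) := hsmin t0 _ (by omega)
      rw [gp_comm hd]
      linarith
  have k1 := hh (σ a) (γ sa) (σ b) p
  have k2 := hh (γ sa) (γ sb) (σ b) p
  rw [hg0] at k1
  have hfin : E ≤ D0 + 1 := by
    by_cases hE1 : E ≤ 1
    · linarith
    have : E ≤ D0 := by
      refine hD E hE0 (fun k hk => ?_)
      have hpk := hpath (k + 1) (by rw [pow_succ]; linarith)
      push_cast at hpk
      have hkδ : 0 ≤ (k : ℝ) * δ := by positivity
      have k2' : E - M - (k + 1 : ℝ) * δ - 2 - δ ≤ gp d p (γ sa) (σ b) := by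
        refine le_trans ?_ k2
        rcases min_choice (gp d p (γ sa) (γ sb)) (gp d p (γ sb) (σ b)) with h | h <;>
          rw [h] <;> linarith
      rcases min_choice (gp d p (σ a) (γ sa)) (gp d p (γ sa) (σ b)) with h | h <;>
          rw [h] at k1 <;> linarith
    linarith
  exact hfin

theorem crossing (P : ℕ → Prop) (n : ℕ) (h0 : P 0) (hn : ¬ P n) :
    ∃ t < n, P t ∧ ¬ P (t + 1) := by
  induction n with
  | zero => exact absurd h0 hn
  | succ n ih =>
    by_cases h : P n
    · exact ⟨n, by omega, h, hn⟩
    · obtain ⟨t, ht, h1⟩ := ih h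
      exact ⟨t, by omega, h1⟩

/-- Morse lemma, in terms of Gromov products. -/
theorem morse2 {d d' : X → X → ℝ} (hd : IsPseudometric d) (hd' : IsPseudometric d')
    (hg : Geod d) (hg' : Geod d') {δ M : ℝ} (hδ : 0 ≤ δ)
    (hM : 0 ≤ M) (hh : GromovHyperbolic d δ)
    (hle : ∀ x y, d' x y ≤ d x y) (hge : ∀ x y, d x y ≤ M * d' x y) :
    ∃ C1 : ℝ, 0 ≤ C1 ∧ (∀ (n' : ℕ) (γ : ℕ → X),
      (∀ i j : ℕ, i ≤ j → j ≤ n' → d' (γ i) (γ j) = (j : ℝ) - (i : ℝ)) →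
      ∀ s ≤ n', gp d (γ s) (γ 0) (γ n') ≤ C1) ∧
      ∀ p x y : X, gp d' p x y ≤ gp d p x y + C1 := by
  obtain ⟨D0, hD0, hD⟩ := morse1 hd hδ hM hh hle hge
  refine ⟨M * (2 * D0 + 1) + D0 + 1 + 2 * δ, by positivity, ?_, ?_⟩
  · intro n' γ hγ s hs
    obtain ⟨n, σ, h0, hn, hσ⟩ := hg (γ 0) (γ n')
    have hDs := hD n n' σ γ h0 hn hσ hγ
    suffices hS : ∃ t ≤ n, d (γ s) (σ t) ≤ M * (2 * D0 + 1) + D0 by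
      obtain ⟨t, ht, hts⟩ := hS
      have h1 := gp_le_gp_add hd (γ s) (σ t) (γ 0) (γ n')
      have h2 : gp d (σ t) (γ 0) (γ n') = 0 := by
        rw [← h0, ← hn]
        unfold gp
        rw [hσ _ _ (Nat.zero_le t) ht, hd.2.1, hσ _ _ ht le_rfl, hσ _ _ (Nat.zero_le _) le_rfl]
        ring
      linarith
    have hMD : 0 ≤ M * (2 * D0 + 1) := by positivity
    by_cases hc : ∃ a ≤ n', s ≤ a ∧ d (σ 0) (γ a) ≤ D0
    · obtain ⟨a, ha, hsa, hda⟩ := hc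
      refine ⟨0, Nat.zero_le _, ?_⟩
      have h1 : (a : ℝ) ≤ D0 := by
        have := hγ 0 a (Nat.zero_le _) ha
        rw [h0] at hda
        have h2 := hle (γ 0) (γ a)
        simp at this
        linarith
      have h3 : (s : ℝ) ≤ a := by exact_mod_cast hsa
      have h4 := hge (γ 0) (γ s)
      rw [hγ 0 s (Nat.zero_le _) hs] at h4
      rw [h0, hd.2.1]
      refine h4.trans ?_
      have : M * ((s : ℝ) - (0 : ℕ)) ≤ M * (2 * D0 + 1) :=
        mul_le_mul_of_nonneg_left (by simp; linarith) hM
      linarith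
    by_cases hc2 : s = n'
    · refine ⟨n, le_rfl, ?_⟩
      rw [hn, hc2, hd.1]
      positivity
    have hcr := crossing (fun t => ¬ ∃ a ≤ n', s ≤ a ∧ d (σ t) (γ a) ≤ D0) n hc
      (by
        push Not
        refine ⟨n', le_rfl, hs, ?_⟩
        rw [hn, hd.1]; exact hD0)
    obtain ⟨t, ht, ht1, ht2⟩ := hcr
    push Not at ht2
    obtain ⟨b, hb, hsb, hdb⟩ := ht2
    obtain ⟨a, ha, hda⟩ := hDs t ht.le
    have has : a ≤ s := by
      by_contra hcc
      exact ht1 ⟨a, ha, by omega, hda⟩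
    have hst := hσ t (t + 1) (by omega) (by omega)
    push_cast at hst
    have h1 : d (γ a) (γ b) ≤ 2 * D0 + 1 := by
      have h1 := hd.2.2 (γ a) (σ t) (γ b)
      have h2 := hd.2.2 (σ t) (σ (t + 1)) (γ b)
      rw [hd.2.1 (γ a) (σ t)] at h1
      linarith
    have h2 : (b : ℝ) - a ≤ 2 * D0 + 1 := by
      rw [← hγ a b (has.trans hsb) hb]
      exact (hle _ _).trans h1
    have h3 : d (γ a) (γ s) ≤ M * (2 * D0 + 1) := by
      refine (hge _ _).trans (mul_le_mul_of_nonneg_left ?_ hM)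
      rw [hγ a s has hs]
      have : (s : ℝ) ≤ b := by exact_mod_cast hsb
      linarith
    refine ⟨t, ht.le, ?_⟩
    have h4 := hd.2.2 (γ s) (γ a) (σ t)
    rw [hd.2.1 (γ s) (γ a), hd.2.1 (γ a) (σ t)] at h4
    linarith
  · intro p x y
    obtain ⟨n, σ, h0, hn, hσ⟩ := hg x y
    obtain ⟨n', γ, h0', hn', hγ⟩ := hg' x y
    have hDs := hD n n' σ γ (h0.trans h0'.symm) (hn.trans hn'.symm) hσ hγ
    have hgx := gp_nonneg hd x p y
    set t := ⌊gp d x p y⌋₊ with htdef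
    have ht1 : (t : ℝ) ≤ gp d x p y := Nat.floor_le hgx
    have ht2 : gp d x p y < t + 1 := Nat.lt_floor_add_one _
    have hdxy : d x y = n := by
      rw [← h0, ← hn, hσ _ _ (Nat.zero_le _) le_rfl]; simp
    have htn : t ≤ n := by
      have h1 := hd.2.2 p y x
      have : gp d x p y ≤ n := by
        rw [← hdxy]
        unfold gp
        rw [hd.2.1 y x] at *
        linarith
      exact_mod_cast ht1.trans this
    have hdt : d x (σ t) = t := by
      rw [← h0, hσ _ _ (Nat.zero_le _) htn]; simp
    have hdty : d (σ t) y = n - t := by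
      rw [← hn, hσ _ _ htn le_rfl]
    have hpt : d p (σ t) ≤ gp d p x y + 1 + 2 * δ := by
      have h1 := hh p y (σ t) x
      have h2 : gp d x y (σ t) = t := by
        unfold gp
        rw [hd.2.1 y x, hd.2.1 (σ t) x, hd.2.1 y (σ t), hdt, hdty, hdxy]; ring
      rw [h2, min_eq_right ht1] at h1
      unfold gp at *
      rw [hd.2.1 (σ t) x, hdt] at h1
      rw [hd.2.1 y x] at ht2
      rw [hd.2.1 x p, hd.2.1 y p]
      linarith
    obtain ⟨s, hs, hds⟩ := hDs t htn
    have h5 : d' p (γ s) ≤ gp d p x y + 1 + 2 * δ + D0 := by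
      have := hd.2.2 p (σ t) (γ s)
      have := hle p (γ s)
      linarith
    have h6 := gp_le_gp_add hd' p (γ s) x y
    have h7 : gp d' (γ s) x y = 0 := by
      rw [← h0', ← hn']
      unfold gp
      rw [hγ _ _ (Nat.zero_le s) hs, hd'.2.1, hγ _ _ hs le_rfl, hγ _ _ (Nat.zero_le _) le_rfl]
      ring
    have hMD : 0 ≤ M * (2 * D0 + 1) := by positivity
    linarith

/-- Quasi-isometry invariance of hyperbolicity (in the form needed). -/
theorem qi_hyp {d d' : X → X → ℝ} (hd : IsPseudometric d) (hd' : IsPseudometric d')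
    (hg : Geod d) (hg' : Geod d') {δ M : ℝ} (hδ : 0 ≤ δ)
    (hM : 0 ≤ M) (hh : GromovHyperbolic d δ)
    (hle : ∀ x y, d' x y ≤ d x y) (hge : ∀ x y, d x y ≤ M * d' x y) :
    ∃ δ' ≥ (0 : ℝ), GromovHyperbolic d' δ' := by
  obtain ⟨C1, hC1, hA, hB⟩ := morse2 hd hd' hg hg' hδ hM hh hle hge
  -- slim triangles
  set C := 2 * C1 + δ with hC
  have hC0 : 0 ≤ C := by positivity
  have slim : ∀ (y : X) (n : ℕ) (γ : ℕ → X),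
      (∀ i j : ℕ, i ≤ j → j ≤ n → d' (γ i) (γ j) = (j : ℝ) - (i : ℝ)) →
      ∀ s ≤ n, gp d' (γ s) (γ 0) y ≤ C ∨ gp d' (γ s) y (γ n) ≤ C := by
    intro y n γ hγ s hs
    have h1 := hA n γ hγ s hs
    have h2 := hh (γ 0) y (γ n) (γ s)
    have h3 := hB (γ s) (γ 0) y
    have h4 := hB (γ s) y (γ n)
    rcases min_choice (gp d (γ s) (γ 0) y) (gp d (γ s) y (γ n)) with h | h <;> rw [h] at h2
    · left; linarith
    · right; linarith
  refine ⟨3 * C + 2, by positivity, fun x y z w => ?_⟩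
  obtain ⟨n, γ, h0, hn, hγ⟩ := hg' x z
  have hpt : ∃ s ≤ n, d' w (γ s) ≤ gp d' w x z + 2 * C + 2 := by
    by_cases hc : gp d' (γ n) (γ 0) w ≤ C
    · refine ⟨n, le_rfl, ?_⟩
      rw [hn, h0] at hc
      unfold gp at *
      rw [hd'.2.1 w z] at hc
      rw [hn, hd'.2.1 w z]
      have h1 := hd'.2.2 z x w
      rw [hd'.2.1 z x] at h1
      linarith
    · obtain ⟨t, ht, ht1, ht2⟩ := crossing (fun s => gp d' (γ s) (γ 0) w ≤ C) n (by
        simp only [gp, hd'.1]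
        rw [hd'.2.1 w]
        linarith) hc
      have h3 := (slim w n γ hγ (t + 1) (by omega)).resolve_left ht2
      have h4 := gp_le_gp_add hd' (γ t) (γ (t + 1)) w (γ n)
      rw [hγ t (t + 1) (by omega) (by omega)] at h4
      push_cast at h4
      refine ⟨t, ht.le, ?_⟩
      have e1 := hd'.2.2 x (γ t) z
      rw [h0] at ht1
      rw [hn] at h3 h4
      unfold gp at *
      rw [hd'.2.1 x w] at *
      rw [hd'.2.1 z w] at *
      rw [hd'.2.1 (γ t) z] at e1
      linarith
  obtain ⟨s, hs, hws⟩ := hpt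
  rcases slim y n γ hγ s hs with h | h
  · have h1 := gp_le_gp_add hd' w (γ s) x y
    rw [h0] at h
    have := min_le_left (gp d' w x y) (gp d' w y z)
    linarith
  · have h1 := gp_le_gp_add hd' w (γ s) y z
    rw [hn] at h
    have := min_le_right (gp d' w x y) (gp d' w y z)
    linarith

/-! ### Part 2: word metrics -/

theorem wordNorm_le_of_list {S : Set G} (l : List G) (hl : ∀ y ∈ l, y ∈ S) :
    wordNorm S l.prod ≤ l.length := by
  refine Nat.sInf_le ⟨fun i => l.get i, fun i => hl _ (List.get_mem l i), ?_⟩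
  congr 1
  exact List.ofFn_get l

theorem wordNorm_spec {S : Set G} (hS : GenSymm S) (w : G) :
    ∃ l : List G, l.length = wordNorm S w ∧ (∀ y ∈ l, y ∈ S) ∧ l.prod = w := by
  have hne : {k : ℕ | ∃ f : Fin k → G, (∀ i, f i ∈ S) ∧ (List.ofFn f).prod = w}.Nonempty := by
    have hw : w ∈ (Subgroup.closure S).toSubmonoid := by rw [hS.2]; trivial
    rw [Subgroup.closure_toSubmonoid] at hw
    obtain ⟨l, hl, hp⟩ := Submonoid.exists_list_of_mem_closure hw
    refine ⟨l.length, fun i => l.get i, fun i => ?_, ?_⟩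
    · rcases hl _ (List.get_mem l i) with h | h
      · exact h
      · simpa using hS.1 _ h
    · rw [← hp]
      congr 1
      exact List.ofFn_get l
  obtain ⟨f, hf, hp⟩ := Nat.sInf_mem hne
  refine ⟨List.ofFn f, by simp [wordNorm], fun y hy => ?_, hp⟩
  obtain ⟨i, rfl⟩ := (List.mem_ofFn' f y).1 hy
  exact hf i

theorem wordNorm_one {S : Set G} : wordNorm S (1 : G) = 0 := by
  have := wordNorm_le_of_list (S := S) ([] : List G) (by simp)
  simpa using this

theorem wordNorm_mul {S : Set G} (hS : GenSymm S) (g h : G) :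
    wordNorm S (g * h) ≤ wordNorm S g + wordNorm S h := by
  obtain ⟨l, hl, hl1, rfl⟩ := wordNorm_spec hS g
  obtain ⟨m, hm, hm1, rfl⟩ := wordNorm_spec hS h
  rw [← hl, ← hm, ← List.prod_append, ← List.length_append]
  apply wordNorm_le_of_list
  intro y hy
  rcases List.mem_append.1 hy with h | h
  · exact hl1 y h
  · exact hm1 y h

theorem wordNorm_inv_le {S : Set G} (hS : GenSymm S) (g : G) :
    wordNorm S g⁻¹ ≤ wordNorm S g := by
  obtain ⟨l, hl, hl1, rfl⟩ := wordNorm_spec hS g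
  rw [← hl, List.prod_inv_reverse]
  refine (wordNorm_le_of_list _ ?_).trans (by simp)
  intro y hy
  simp only [List.mem_reverse, List.mem_map] at hy
  obtain ⟨a, ha, rfl⟩ := hy
  exact hS.1 _ (hl1 _ ha)

theorem wordNorm_inv {S : Set G} (hS : GenSymm S) (g : G) :
    wordNorm S g⁻¹ = wordNorm S g := by
  refine le_antisymm (wordNorm_inv_le hS g) ?_
  simpa using wordNorm_inv_le hS g⁻¹

theorem wordDist_psm {S : Set G} (hS : GenSymm S) : IsPseudometric (wordDist S) := by
  refine ⟨fun x => by simp [wordDist, wordNorm_one], fun x y => ?_, fun x y z => ?_⟩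
  · unfold wordDist
    rw [← wordNorm_inv hS]
    simp
  · unfold wordDist
    have := wordNorm_mul hS (x⁻¹ * y) (y⁻¹ * z)
    rw [show x⁻¹ * y * (y⁻¹ * z) = x⁻¹ * z by group] at this
    exact_mod_cast this

theorem wordDist_inv {S : Set G} : LeftInvariant (wordDist S) := by
  intro g x y
  unfold wordDist
  rw [show (g * x)⁻¹ * (g * y) = x⁻¹ * y by group]

theorem wordDist_one_left {S : Set G} (g : G) : wordDist S 1 g = wordNorm S g := by
  simp [wordDist]

theorem wordDist_one_right {S : Set G} (hS : GenSymm S) (g : G) :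
    wordDist S g 1 = wordNorm S g := by
  rw [(wordDist_psm hS).2.1, wordDist_one_left]

theorem wordDist_geod {S : Set G} (hS : GenSymm S) : Geod (wordDist S) := by
  intro x y
  obtain ⟨l, hl, hl1, hp⟩ := wordNorm_spec hS (x⁻¹ * y)
  have hup : ∀ i j : ℕ, i ≤ j → j ≤ l.length →
      wordDist S (x * (l.take i).prod) (x * (l.take j).prod) ≤ (j : ℝ) - i := by
    intro i j hij hj
    rw [wordDist_inv]
    have e : (l.take j).prod = (l.take i).prod * ((l.take j).drop i).prod := by
      rw [← List.prod_append]
      congr 1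
      conv_lhs => rw [← List.take_append_drop i (l.take j)]
      rw [List.take_take, min_eq_left hij]
    unfold wordDist
    rw [e, inv_mul_cancel_left]
    have h := wordNorm_le_of_list (S := S) ((l.take j).drop i)
      (fun y hy => hl1 y (List.mem_of_mem_take (List.mem_of_mem_drop hy)))
    simp only [List.length_drop, List.length_take, min_eq_left hj] at h
    have h2 : ((wordNorm S ((l.take j).drop i).prod : ℕ) : ℝ) ≤ ((j - i : ℕ) : ℝ) := by
      exact_mod_cast h
    rwa [Nat.cast_sub hij] at h2
  refine ⟨l.length, fun i => x * (l.take i).prod, by simp, by simp [hp], ?_⟩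
  intro i j hij hj
  refine le_antisymm (hup i j hij hj) ?_
  have h1 := hup 0 i (Nat.zero_le _) (hij.trans hj)
  have h2 := hup j l.length hj le_rfl
  have h3 : wordDist S (x * (l.take 0).prod) (x * (l.take l.length).prod) = l.length := by
    rw [List.take_length, hp]
    simp [wordDist, hl]
  have hd := wordDist_psm hS
  have h4 := hd.2.2 (x * (l.take 0).prod) (x * (l.take i).prod) (x * (l.take l.length).prod)
  have h5 := hd.2.2 (x * (l.take i).prod) (x * (l.take j).prod) (x * (l.take l.length).prod)
  push_cast at h1
  linarith

theorem ball_finite (T : Finset G) (hT : GenSymm (T : Set G)) (r : ℕ) :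
    ∃ F : Finset G, F.card ≤ (T.card + 1) ^ r ∧ ∀ g, wordNorm (T : Set G) g ≤ r → g ∈ F := by
  classical
  open scoped Pointwise in
  refine ⟨(insert 1 T) ^ r, ?_, fun g hg => ?_⟩
  · exact Finset.card_pow_le.trans (Nat.pow_le_pow_left (Finset.card_insert_le _ _) _)
  · obtain ⟨l, hl, hl1, rfl⟩ := wordNorm_spec hT g
    rw [← hl] at hg
    refine Finset.pow_subset_pow_right (Finset.mem_insert_self _ _) hg ?_
    clear hg hl
    induction l with
    | nil => simp
    | cons a l ih =>
      rw [List.prod_cons, List.length_cons, pow_succ']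
      refine Finset.mul_mem_mul (Finset.mem_insert_of_mem ?_) (ih ?_)
      · exact_mod_cast hl1 a (by simp)
      · exact fun y hy => hl1 y (by simp [hy])

/-- comparison between word norms -/
theorem wordNorm_compare {S T : Set G} (hS : GenSymm S) (hT : GenSymm T) (M : ℕ)
    (hM : ∀ t ∈ T, wordNorm S t ≤ M) (g : G) : wordNorm S g ≤ M * wordNorm T g := by
  obtain ⟨l, hl, hl1, rfl⟩ := wordNorm_spec hT g
  rw [← hl]
  clear hl
  induction l with
  | nil => simp [wordNorm_one]
  | cons a l ih =>
    rw [List.prod_cons, List.length_cons]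
    refine (wordNorm_mul hS _ _).trans ?_
    have h1 := hM a (hl1 a (by simp))
    have h2 := ih (fun y hy => hl1 y (by simp [hy]))
    rw [Nat.mul_succ]
    omega

theorem wordNorm_mem {S : Set G} {s : G} (hs : s ∈ S) : wordNorm S s ≤ 1 := by
  have := wordNorm_le_of_list (S := S) [s] (by simpa using hs)
  simpa using this

theorem super_inD (S T : Finset G) (hST : S ⊆ T) (hS : GenSymm (S : Set G))
    (hT : GenSymm (T : Set G)) {δ : ℝ} (hδ : 0 ≤ δ)
    (hh : GromovHyperbolic (wordDist (S : Set G)) δ) : InD (wordDist (T : Set G)) := by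
  refine ⟨wordDist_psm hT, wordDist_inv, ?_, T, hT, 1, 1, 0, one_pos, one_pos, le_rfl,
    fun x y => by simp⟩
  set M : ℕ := T.sup (fun t => wordNorm (S : Set G) t) with hM
  refine qi_hyp (wordDist_psm hS) (wordDist_psm hT) (wordDist_geod hS) (wordDist_geod hT) hδ
    (M := M) (Nat.cast_nonneg _) hh (fun x y => ?_) (fun x y => ?_)
  · unfold wordDist
    have := wordNorm_compare hT hS 1 (fun t ht => wordNorm_mem (by exact_mod_cast hST ht))
      (x⁻¹ * y)
    exact_mod_cast this.trans (by simp)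
  · unfold wordDist
    have := wordNorm_compare hS hT M (fun t ht =>
      Finset.le_sup (f := fun t => wordNorm (S : Set G) t) (by exact_mod_cast ht)) (x⁻¹ * y)
    exact_mod_cast this

/-! ### Part 3: hyperbolic norms on groups -/

/-- Gromov product of a norm at the identity. -/
def np (N : G → ℝ) (g h : G) : ℝ := (N g + N h - N (g⁻¹ * h)) / 2

/-- A hyperbolic norm on a group. -/
structure HypNorm (N : G → ℝ) (δ : ℝ) : Prop where
  one : N 1 = 0
  inv : ∀ g, N g⁻¹ = N g
  mul : ∀ g h, N (g * h) ≤ N g + N h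
  hyp : ∀ g h k, min (np N g h) (np N h k) - δ ≤ np N g k

namespace HypNorm

variable {N : G → ℝ} {δ : ℝ}

theorem nonneg (hN : HypNorm N δ) (g : G) : 0 ≤ N g := by
  have h1 := hN.mul g g⁻¹
  rw [mul_inv_cancel, hN.one, hN.inv] at h1
  linarith

theorem np_comm (hN : HypNorm N δ) (g h : G) : np N g h = np N h g := by
  unfold np
  rw [← hN.inv (g⁻¹ * h)]
  simp [add_comm]

theorem np_nonneg (hN : HypNorm N δ) (g h : G) : 0 ≤ np N g h := by
  have h1 := hN.mul g⁻¹ h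
  rw [hN.inv] at h1
  unfold np
  linarith

theorem np_le_left (hN : HypNorm N δ) (g h : G) : np N g h ≤ N g := by
  have h1 := hN.mul g (g⁻¹ * h)
  rw [mul_inv_cancel_left] at h1
  unfold np
  linarith

theorem np_le_right (hN : HypNorm N δ) (g h : G) : np N g h ≤ N h := by
  rw [hN.np_comm]
  exact hN.np_le_left h g

/-- change of base point -/
theorem np_mul (hN : HypNorm N δ) (g h : G) : np N (g * h) g = N g - np N g⁻¹ h := by
  unfold np
  rw [← hN.inv ((g * h)⁻¹ * g), hN.inv g]
  simp
  ring

theorem norm_mul (N : G → ℝ) (hinv : ∀ g, N g⁻¹ = N g) (g h : G) :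
    N (g * h) = N g + N h - 2 * np N g⁻¹ h := by
  unfold np
  rw [hinv, inv_inv]
  ring

theorem hyp' (hN : HypNorm N δ) {g h k : G} {c : ℝ} (h1 : np N g k ≤ c)
    (h2 : c + δ < np N h k) : np N g h ≤ c + δ := by
  have := hN.hyp g h k
  rcases min_choice (np N g h) (np N h k) with e | e <;> rw [e] at this <;> linarith

/-- one-sided local-to-global -/
theorem lox1 (hN : HypNorm N δ) (hδ : 0 ≤ δ) {x : G} {κ : ℝ} (h1 : np N x⁻¹ x ≤ κ)
    (h2 : 2 * κ + 3 * δ < N x) (n : ℕ) : np N (x ^ n)⁻¹ x ≤ κ + δ := by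
  have hκ : 0 ≤ κ := (hN.np_nonneg _ _).trans h1
  induction n with
  | zero =>
    simp [np, hN.one]
    linarith
  | succ n ih =>
    have h3 : np N (x ^ (n + 1))⁻¹ x⁻¹ = N x - np N x (x ^ n)⁻¹ := by
      have := hN.np_mul x⁻¹ (x ^ n)⁻¹
      rw [inv_inv, hN.inv, ← mul_inv_rev, ← pow_succ] at this
      exact this
    rw [hN.np_comm x] at h3
    rw [hN.np_comm]
    refine hN.hyp' (k := x⁻¹) ?_ ?_
    · rwa [hN.np_comm]
    · rw [h3]; linarith

theorem lox2 (hN : HypNorm N δ) (hδ : 0 ≤ δ) {x : G} {κ : ℝ} (h1 : np N x⁻¹ x ≤ κ)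
    (h2 : 2 * κ + 3 * δ < N x) (m n : ℕ) : np N (x ^ m)⁻¹ (x ^ n) ≤ κ + 2 * δ := by
  have hκ : 0 ≤ κ := (hN.np_nonneg _ _).trans h1
  cases n with
  | zero =>
    simp [np, hN.one, hN.inv]
    linarith
  | succ n =>
    have h3 := hN.lox1 hδ (x := x⁻¹) (κ := κ) (by rwa [inv_inv, hN.np_comm])
      (by rwa [hN.inv]) n
    rw [inv_pow, inv_inv] at h3
    have h4 := hN.np_mul x (x ^ n)
    rw [← pow_succ', hN.np_comm x⁻¹] at h4
    have h5 := hN.hyp' (g := (x ^ m)⁻¹) (h := x ^ (n + 1)) (k := x) (c := κ + δ)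
      (hN.lox1 hδ h1 h2 m) (by rw [h4]; linarith)
    linarith

theorem lox3 (hN : HypNorm N δ) (hδ : 0 ≤ δ) {x : G} {κ : ℝ} (h1 : np N x⁻¹ x ≤ κ)
    (h2 : 2 * κ + 3 * δ < N x) (n : ℕ) : n * (N x - 2 * κ - 2 * δ) ≤ N (x ^ n) := by
  induction n with
  | zero => simp [hN.one]
  | succ n ih =>
    have h3 := norm_mul N hN.inv (x ^ n) x
    have h4 := hN.lox1 hδ h1 h2 n
    rw [pow_succ, h3]
    push_cast
    linarith

/-- Existence of a loxodromic element. -/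
theorem exists_lox (hN : HypNorm N δ) (hδ : 1 ≤ δ) {u v : G} {R : ℝ} (hu : N u = R)
    (hv : N v = R) (hR : 100 * δ ≤ R) (huv : np N u v ≤ 0) :
    ∃ (x : G) (κ : ℝ), np N x⁻¹ x ≤ κ ∧ 2 * κ + 3 * δ < N x := by
  by_cases hcu : np N u⁻¹ u ≤ R / 2 - 2 * δ
  · exact ⟨u, _, hcu, by rw [hu]; linarith⟩
  by_cases hcv : np N v⁻¹ v ≤ R / 2 - 2 * δ
  · exact ⟨v, _, hcv, by rw [hv]; linarith⟩
  push Not at hcu hcv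
  have e1 : np N u⁻¹ v ≤ δ := by
    rw [hN.np_comm]
    have := hN.hyp' (g := v) (h := u⁻¹) (k := u) (c := 0) (by rwa [hN.np_comm]) (by linarith)
    linarith
  have e2 : np N v⁻¹ u ≤ δ := by
    rw [hN.np_comm]
    have := hN.hyp' (g := u) (h := v⁻¹) (k := v) (c := 0) huv (by linarith)
    linarith
  have f1 := hN.np_mul u v
  have f2 := hN.np_mul v⁻¹ u⁻¹
  rw [inv_inv, hN.inv, ← mul_inv_rev, hN.np_comm v] at f2
  refine ⟨u * v, 3 * δ, ?_, ?_⟩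
  · have g1 : np N u (u * v)⁻¹ ≤ 2 * δ := by
      have := hN.hyp' (g := u) (h := (u * v)⁻¹) (k := v⁻¹) (c := δ)
        (by rwa [hN.np_comm]) (by rw [f2]; linarith)
      linarith
    have := hN.hyp' (g := (u * v)⁻¹) (h := u * v) (k := u) (c := 2 * δ)
      (by rwa [hN.np_comm]) (by rw [f1]; linarith)
    linarith
  · rw [norm_mul N hN.inv]
    linarith

theorem disc_ivt (hN : HypNorm N δ) (x : G) {t : ℝ} (ht : 0 ≤ t) (n : ℕ)
    (hn : t ≤ N (x ^ n)) : ∃ j ≤ n, N (x ^ j) ≤ t ∧ t ≤ N (x ^ j) + N x := by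
  have hx := hN.nonneg x
  induction n with
  | zero =>
    simp only [pow_zero, hN.one] at hn
    exact ⟨0, le_rfl, by simp [hN.one, ht], by simp [hN.one]; linarith⟩
  | succ n ih =>
    by_cases h : t ≤ N (x ^ n)
    · obtain ⟨j, hj, h1⟩ := ih h
      exact ⟨j, by omega, h1⟩
    · push Not at h
      refine ⟨n, by omega, h.le, ?_⟩
      have := hN.mul (x ^ n) x
      rw [← pow_succ] at this
      linarith

/-- An element whose nearest power of `x` is the identity has bounded product with the axis. -/
theorem third_dir (hN : HypNorm N δ) {x h : G} {K : ℝ}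
    (hK : ∀ m n : ℕ, np N (x ^ m)⁻¹ (x ^ n) ≤ K)
    (hmin : ∀ j : ℕ, N h ≤ N ((x ^ j)⁻¹ * h)) (n : ℕ) :
    np N h (x ^ n) ≤ 2 * (N x + K + δ) := by
  set t := np N h (x ^ n) with ht
  obtain ⟨j, hj, h1, h2⟩ := hN.disc_ivt x (hN.np_nonneg h (x ^ n)) n (hN.np_le_right _ _)
  have h3 := hN.np_mul (x ^ j) (x ^ (n - j))
  rw [← pow_add, Nat.add_sub_cancel' hj] at h3
  have h4 := hK j (n - j)
  have hK0 : 0 ≤ K := (hN.np_nonneg _ _).trans h4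
  have hx := hN.nonneg x
  have h5 := hN.hyp h (x ^ n) (x ^ j)
  have h6 : t - N x - K ≤ min (np N h (x ^ n)) (np N (x ^ n) (x ^ j)) := by
    refine le_min ?_ ?_
    · linarith
    · rw [h3]; linarith
  have h7 := hmin j
  have h8 : N ((x ^ j)⁻¹ * h) = N (x ^ j) + N h - 2 * np N (x ^ j) h := by
    unfold np; ring
  rw [hN.np_comm] at h8
  linarith

section tree

variable {K R : ℝ} {c : G → Bool → G}

/-- the branching tree -/
def tr (c : G → Bool → G) : G → List Bool → G
  | p, [] => p
  | p, b :: l => tr c (p * c p b) l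

theorem tr_norm (hN : HypNorm N δ) {M : ℝ} (hM : ∀ p b, N (c p b) ≤ M) (l : List Bool) :
    ∀ p, N (tr c p l) ≤ N p + M * l.length := by
  induction l with
  | nil => intro p; simp [tr]
  | cons b l ih =>
    intro p
    have h1 := ih (p * c p b)
    have h2 := hN.mul p (c p b)
    have h3 := hM p b
    simp only [tr, List.length_cons]
    push_cast
    linarith

theorem tr_np (hN : HypNorm N δ) (hδ : 0 ≤ δ) (hK : 0 ≤ K) (hR : 4 * K + 5 * δ < R)
    (hc1 : ∀ p b, R ≤ N (c p b))
    (hc2 : ∀ p b, np N p⁻¹ (c p b) ≤ K + δ) (l : List Bool) :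
    ∀ p, N p - (K + δ) - δ ≤ np N (tr c p l) p := by
  induction l with
  | nil => intro p; simp [tr, np, hN.one]; linarith
  | cons b l ih =>
    intro p
    simp only [tr]
    have h1 := ih (p * c p b)
    have h2 := hN.np_mul p (c p b)
    have h3 := hc2 p b
    have h4 := norm_mul N hN.inv p (c p b)
    have h5 := hc1 p b
    have h6 := hN.hyp (tr c (p * c p b) l) (p * c p b) p
    have h7 : N p - (K + δ) ≤ min (np N (tr c (p * c p b) l) (p * c p b))
        (np N (p * c p b) p) := by
      refine le_min ?_ ?_ <;> linarith
    linarith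

theorem tr_inj (hN : HypNorm N δ) (hδ : 0 ≤ δ) (hK : 0 ≤ K) (hR : 4 * K + 5 * δ < R)
    (hc1 : ∀ p b, R ≤ N (c p b))
    (hc2 : ∀ p b, np N p⁻¹ (c p b) ≤ K + δ)
    (hc3 : ∀ p b b', b ≠ b' → np N (c p b) (c p b') ≤ K) (l : List Bool) :
    ∀ p l', l.length = l'.length → tr c p l = tr c p l' → l = l' := by
  induction l with
  | nil => intro p l' h _; simpa [eq_comm] using h
  | cons b l ih =>
    intro p l' hl he
    cases l' with
    | nil => simp at hl
    | cons b' l' =>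
      by_cases hb : b = b'
      · subst hb
        rw [ih _ l' (by simpa using hl) he]
      · exfalso
        simp only [tr] at he
        have h1 := hN.tr_np hδ hK hR hc1 hc2 l (p * c p b)
        have h2 := hN.tr_np hδ hK hR hc1 hc2 l' (p * c p b')
        rw [← he] at h2
        set y := tr c (p * c p b) l
        have h3 := hN.hyp (p * c p b) y (p * c p b')
        rw [hN.np_comm _ y] at h3
        have a1 := norm_mul N hN.inv p (c p b)
        have a2 := norm_mul N hN.inv p (c p b')
        have b1 := hc1 p b
        have b2 := hc1 p b'
        have c1 := hc2 p b
        have c2 := hc2 p b'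
        have d1 := hc3 p b b' hb
        have m1 := hN.mul p (c p b)
        have m2 := hN.mul p (c p b')
        have h4 : N p + R - 3 * (K + δ) - δ ≤
            min (np N y (p * c p b)) (np N y (p * c p b')) := by
          refine le_min ?_ ?_ <;> linarith
        have h5 : np N (p * c p b) (p * c p b') ≤ N p + K := by
          have e : (p * c p b)⁻¹ * (p * c p b') = (c p b)⁻¹ * c p b' := by group
          unfold np at d1 ⊢
          rw [e]
          linarith
        linarith

end tree

/-- Three directions give exponential growth. -/
theorem exp_growth (hN : HypNorm N δ) (hδ : 0 ≤ δ) {K R : ℝ} (hK : 0 ≤ K)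
    (hR : 4 * K + 5 * δ < R) (u v w : G) (hu : R ≤ N u) (hv : R ≤ N v) (hw : R ≤ N w)
    (huv : np N u v ≤ K) (huw : np N u w ≤ K) (hvw : np N v w ≤ K) :
    ∃ M : ℝ, 0 < M ∧ ∀ n : ℕ, ∃ F : Finset G, F.card = 2 ^ n ∧ ∀ g ∈ F, N g ≤ M * n := by
  classical
  have hch : ∀ p : G, ∃ a b : G, (R ≤ N a ∧ R ≤ N b) ∧
      (np N p⁻¹ a ≤ K + δ ∧ np N p⁻¹ b ≤ K + δ) ∧ np N a b ≤ K ∧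
      (N a ≤ N u + N v + N w ∧ N b ≤ N u + N v + N w) := by
    intro p
    have nu := hN.nonneg u
    have nv := hN.nonneg v
    have nw := hN.nonneg w
    by_cases h1 : np N p⁻¹ u ≤ K + δ
    · by_cases h2 : np N p⁻¹ v ≤ K + δ
      · exact ⟨u, v, ⟨hu, hv⟩, ⟨h1, h2⟩, huv, by linarith, by linarith⟩
      · push Not at h2
        have h3 : np N p⁻¹ w ≤ K + δ := by
          rw [hN.np_comm]
          exact hN.hyp' (k := v) (by rwa [hN.np_comm]) h2
        exact ⟨u, w, ⟨hu, hw⟩, ⟨h1, h3⟩, huw, by linarith, by linarith⟩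
    · push Not at h1
      have h2 : np N p⁻¹ v ≤ K + δ := by
        rw [hN.np_comm]
        exact hN.hyp' (k := u) (by rwa [hN.np_comm]) h1
      have h3 : np N p⁻¹ w ≤ K + δ := by
        rw [hN.np_comm]
        exact hN.hyp' (k := u) (by rwa [hN.np_comm]) h1
      exact ⟨v, w, ⟨hv, hw⟩, ⟨h2, h3⟩, hvw, by linarith, by linarith⟩
  choose a b hab1 hab2 hab3 hab4 using hch
  set c : G → Bool → G := fun p t => if t then a p else b p with hc
  have hc1 : ∀ p t, R ≤ N (c p t) := by
    intro p t; cases t <;> simp [hc, hab1 p]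
  have hc2 : ∀ p t, np N p⁻¹ (c p t) ≤ K + δ := by
    intro p t; cases t <;> simp [hc, hab2 p]
  have hc4 : ∀ p t, N (c p t) ≤ N u + N v + N w := by
    intro p t; cases t <;> simp [hc, hab4 p]
  have hc3 : ∀ p t t', t ≠ t' → np N (c p t) (c p t') ≤ K := by
    intro p t t' h
    have := hab3 p
    have h' := hab3 p
    rw [hN.np_comm] at h'
    cases t <;> cases t' <;> simp_all
  refine ⟨N u + N v + N w, ?_, fun n => ?_⟩
  · linarith
  refine ⟨(Finset.univ : Finset (List.Vector Bool n)).image (fun l => tr c 1 l.toList), ?_, ?_⟩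
  · rw [Finset.card_image_of_injective]
    · simp
    · intro l l' h
      apply List.Vector.toList_injective
      exact hN.tr_inj hδ hK hR hc1 hc2 hc3 l.toList 1 l'.toList (by simp) h
  · intro g hg
    simp only [Finset.mem_image, Finset.mem_univ, true_and] at hg
    obtain ⟨l, rfl⟩ := hg
    have := hN.tr_norm hc4 l.toList 1
    simpa [hN.one] using this

end HypNorm

/-! ### Part 4: assembly -/

theorem super_compare (S T : Finset G) (hST : S ⊆ T) (hS : GenSymm (S : Set G))
    (hT : GenSymm (T : Set G)) : ∃ L : ℝ, 0 < L ∧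
      (∀ x y, wordDist (T : Set G) x y ≤ wordDist (S : Set G) x y) ∧
      (∀ x y, wordDist (S : Set G) x y ≤ L * wordDist (T : Set G) x y) := by
  set M : ℕ := T.sup (fun t => wordNorm (S : Set G) t) with hM
  refine ⟨M + 1, by positivity, fun x y => ?_, fun x y => ?_⟩
  · unfold wordDist
    have := wordNorm_compare hT hS 1 (fun t ht => wordNorm_mem (by exact_mod_cast hST ht))
      (x⁻¹ * y)
    exact_mod_cast this.trans (by simp)
  · unfold wordDist
    have := wordNorm_compare hS hT M (fun t ht =>
      Finset.le_sup (f := fun t => wordNorm (S : Set G) t) (by exact_mod_cast ht)) (x⁻¹ * y)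
    have h2 : M * wordNorm (T : Set G) (x⁻¹ * y) ≤ (M + 1) * wordNorm (T : Set G) (x⁻¹ * y) :=
      Nat.mul_le_mul_right _ (by omega)
    exact_mod_cast this.trans h2

theorem lin_le {a b C : ℝ} (h : ∀ k : ℕ, a * k ≤ b * k + C) : a ≤ b := by
  by_contra hc
  push Not at hc
  obtain ⟨k, hk⟩ := exists_nat_gt (C / (a - b))
  have h1 := h k
  rw [div_lt_iff₀ (by linarith)] at hk
  linarith

set_option linter.unusedSectionVars false in
theorem lam_lower {d1 d2 dT dS : G → G → ℝ} (h1 : RSim d1 dT) (h2 : RSim d2 dS) {L a b : ℝ}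
    (hL : 0 < L) (hle : ∀ x y, dT x y ≤ dS x y) (hge : ∀ x y, dS x y ≤ L * dT x y)
    (ha : 0 ≤ a) (hb : 0 ≤ b)
    (H1 : ∀ k : ℕ, ∃ x y, dT x y ≤ k ∧ a * k ≤ dS x y)
    (H2 : ∀ l A : ℝ, 0 < l → 0 ≤ A → (∀ x y, dT x y ≤ l * dS x y + A) → b ≤ l) :
    a * b ≤ Lam d1 d2 := by
  obtain ⟨k1, A1, hk1, hA1, h1⟩ := h1
  obtain ⟨k2, A2, hk2, hA2, h2⟩ := h2
  have u1 : ∀ x y, d1 x y ≤ k1 * dT x y + A1 := fun x y => by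
    have := (abs_le.1 (h1 x y)).2; linarith
  have v1 : ∀ x y, k1 * dT x y ≤ d1 x y + A1 := fun x y => by
    have := (abs_le.1 (h1 x y)).1; linarith
  have u2 : ∀ x y, d2 x y ≤ k2 * dS x y + A2 := fun x y => by
    have := (abs_le.1 (h2 x y)).2; linarith
  have v2 : ∀ x y, k2 * dS x y ≤ d2 x y + A2 := fun x y => by
    have := (abs_le.1 (h2 x y)).1; linarith
  refine le_csInf ?_ ?_
  · refine ⟨_, L * k2 / k1, k1 / k2, (k1 / k2 + k1 / (L * k2)) * A2 + A1, by positivity,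
      by positivity, by positivity, rfl, fun x y => ⟨?_, ?_⟩⟩
    · have e1 : d2 x y / (L * k2 / k1) ≤ k1 * dT x y + k1 / (L * k2) * A2 := by
        rw [div_le_iff₀ (by positivity)]
        have e : (k1 * dT x y + k1 / (L * k2) * A2) * (L * k2 / k1) =
            k2 * (L * dT x y) + A2 := by field_simp
        rw [e]
        have := mul_le_mul_of_nonneg_left (hge x y) hk2.le
        linarith [u2 x y]
      have e2 : 0 ≤ k1 / k2 * A2 := by positivity
      have := v1 x y
      linarith
    · have e1 : k1 * dS x y ≤ k1 / k2 * d2 x y + k1 / k2 * A2 := by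
        have := mul_le_mul_of_nonneg_left (v2 x y) (by positivity : 0 ≤ k1 / k2)
        have e : k1 / k2 * (k2 * dS x y) = k1 * dS x y := by field_simp
        rw [e] at this
        linarith
      have e2 : 0 ≤ k1 / (L * k2) * A2 := by positivity
      have := mul_le_mul_of_nonneg_left (hle x y) hk1.le
      linarith [u1 x y]
  · rintro _ ⟨l1, l2, A, hl1, hl2, hA, rfl, h⟩
    have q1 : a * k2 ≤ k1 * l1 := by
      refine lin_le (C := A2 + l1 * (A + A1)) (fun k => ?_)
      obtain ⟨x, y, hx, hy⟩ := H1 k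
      have f1 := (h x y).1
      have f2 : d2 x y ≤ (d1 x y + A) * l1 := by
        rw [← div_le_iff₀ hl1]; linarith
      have f3 : d1 x y ≤ k1 * k + A1 :=
        (u1 x y).trans (by linarith [mul_le_mul_of_nonneg_left hx hk1.le])
      have f4 : (d1 x y + A) * l1 ≤ (k1 * k + A1 + A) * l1 :=
        mul_le_mul_of_nonneg_right (by linarith) hl1.le
      have f5 := mul_le_mul_of_nonneg_left hy hk2.le
      linarith [v2 x y]
    have q2 : b ≤ l2 * k2 / k1 := by
      refine H2 _ ((l2 * A2 + A + A1) / k1) (by positivity) (by positivity) (fun x y => ?_)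
      have e : l2 * k2 / k1 * dS x y + (l2 * A2 + A + A1) / k1 =
          (l2 * (k2 * dS x y + A2) + A + A1) / k1 := by field_simp; ring
      rw [e, le_div_iff₀ hk1]
      have := mul_le_mul_of_nonneg_left (u2 x y) hl2.le
      linarith [v1 x y, (h x y).2]
    have q3 : a ≤ k1 * l1 / k2 := by rwa [le_div_iff₀ hk2]
    calc a * b ≤ (k1 * l1 / k2) * (l2 * k2 / k1) :=
          mul_le_mul q3 q2 hb (ha.trans q3)
      _ = l1 * l2 := by field_simp

theorem growth_bound {N : G → ℕ} {B : ℕ} (T : Finset G) (hT : GenSymm (T : Set G))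
    (hB : T.card + 1 ≤ B + 3) {M : ℝ} (hM : 0 < M)
    (hgr : ∀ n : ℕ, ∃ F : Finset G, F.card = 2 ^ n ∧ ∀ g ∈ F, (N g : ℝ) ≤ M * n)
    {l A : ℝ} (hl : 0 < l) (hA : 0 ≤ A)
    (H : ∀ g : G, (wordNorm (T : Set G) g : ℝ) ≤ l * N g + A) :
    Real.log 2 / (M * Real.log ((B + 3 : ℕ) : ℝ)) ≤ l := by
  have hlogB : 0 < Real.log ((B + 3 : ℕ) : ℝ) :=
    Real.log_pos (by push_cast; have : (0 : ℝ) ≤ B := Nat.cast_nonneg _; linarith)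
  rw [div_le_iff₀ (mul_pos hM hlogB)]
  set lb := Real.log ((B + 3 : ℕ) : ℝ) with hlb
  refine lin_le (C := (A + 1) * lb) (fun n => ?_)
  obtain ⟨F, hF, hFg⟩ := hgr n
  set r := ⌈l * (M * n) + A⌉₊ with hr
  have hr1 : (r : ℝ) < l * (M * n) + A + 1 := Nat.ceil_lt_add_one (by positivity)
  obtain ⟨E, hE, hEg⟩ := ball_finite T hT r
  have hFE : F ⊆ E := by
    intro g hg
    refine hEg g ?_
    have h1 := (H g).trans
      (add_le_add_left (mul_le_mul_of_nonneg_left (hFg g hg) hl.le) A)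
    exact_mod_cast h1.trans (Nat.le_ceil _)
  have h2 : 2 ^ n ≤ (B + 3) ^ r := by
    rw [← hF]
    exact (Finset.card_le_card hFE).trans (hE.trans (Nat.pow_le_pow_left hB r))
  have h3 : ((2 : ℝ)) ^ n ≤ ((B + 3 : ℕ) : ℝ) ^ r := by exact_mod_cast h2
  have h4 := Real.log_le_log (by positivity) h3
  rw [Real.log_pow, Real.log_pow, ← hlb] at h4
  have h5 := mul_le_mul_of_nonneg_right hr1.le hlogB.le
  linarith

theorem wordNorm_hypNorm {S : Set G} (hS : GenSymm S) {δ : ℝ}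
    (hh : GromovHyperbolic (wordDist S) δ) :
    HypNorm (fun g => (wordNorm S g : ℝ)) δ := by
  refine ⟨by simp [wordNorm_one], fun g => by rw [wordNorm_inv hS],
    fun g h => by exact_mod_cast wordNorm_mul hS g h, fun g h k => ?_⟩
  have := hh g h k 1
  simpa only [gp, wordDist_one_right hS, wordDist, inv_one, np, mul_one, wordNorm_inv hS]
    using this

/-- Loxodromic element and exponential growth. -/
theorem group_main (S : Finset G) (hS : GenSymm (S : Set G)) {δ : ℝ} (hδ : 0 ≤ δ)
    (hh : GromovHyperbolic (wordDist (S : Set G)) δ) (hne : NonElementary G) :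
    ∃ (x : G) (c : ℝ), 0 < c ∧ (∀ n : ℕ, c * n ≤ wordNorm (S : Set G) (x ^ n)) ∧
      ∃ M : ℝ, 0 < M ∧ ∀ n : ℕ, ∃ F : Finset G, F.card = 2 ^ n ∧
        ∀ g ∈ F, (wordNorm (S : Set G) g : ℝ) ≤ M * n := by
  have hh1 : GromovHyperbolic (wordDist (S : Set G)) (δ + 1) := by
    intro x y z w
    have := hh x y z w
    linarith
  have hN := wordNorm_hypNorm hS hh1
  have hδ1 : 1 ≤ δ + 1 := by linarith
  have hδ0 : 0 ≤ δ + 1 := by linarith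
  set N : G → ℝ := fun g => (wordNorm (S : Set G) g : ℝ) with hNdef
  -- a virtually cyclic group is excluded
  have hcyc : ∀ (x : G) (D : ℕ), ∃ g : G, ∀ k : ℤ, D < wordNorm (S : Set G) (x ^ k * g) := by
    intro x D
    by_contra hcon
    push Not at hcon
    obtain ⟨F, -, hF⟩ := ball_finite S hS D
    apply hne
    refine ⟨Subgroup.zpowers x, ?_, ?_⟩
    · have hsurj : Function.Surjective
          (fun b : F => ((b.1⁻¹ : G) : G ⧸ Subgroup.zpowers x)) := by
        intro q
        obtain ⟨g, rfl⟩ := QuotientGroup.mk_surjective q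
        obtain ⟨k, hk⟩ := hcon g⁻¹
        refine ⟨⟨_, hF _ hk⟩, ?_⟩
        refine QuotientGroup.eq.2 ?_
        refine ⟨k, ?_⟩
        simp
      have : Finite (G ⧸ Subgroup.zpowers x) := Finite.of_surjective _ hsurj
      exact Subgroup.finiteIndex_of_finite_quotient
    · rintro a ⟨m, rfl⟩ b ⟨n, rfl⟩
      simp only
      rw [← zpow_add, ← zpow_add, add_comm]
  -- loxodromic element
  obtain ⟨x, κ, hx1, hx2⟩ : ∃ (x : G) (κ : ℝ), np N x⁻¹ x ≤ κ ∧ 2 * κ + 3 * (δ + 1) < N x := by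
    obtain ⟨R, hR⟩ := exists_nat_ge (100 * (δ + 1))
    obtain ⟨g, hg⟩ := hcyc 1 (2 * R)
    have hg := hg 0
    simp only [zpow_zero, one_mul] at hg
    obtain ⟨n, γ, h0, hn, hγ⟩ := wordDist_geod hS 1 g
    have hn2 : 2 * R ≤ n := by
      have h1 := hγ 0 n (Nat.zero_le _) le_rfl
      rw [h0, hn, wordDist_one_left] at h1
      have h2 : wordNorm (S : Set G) g = n := by
        have : (wordNorm (S : Set G) g : ℝ) = n := by simpa using h1
        exact_mod_cast this
      omega
    have e1 := hγ 0 R (Nat.zero_le _) (by omega)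
    have e2 := hγ R (2 * R) (by omega) hn2
    have e3 := hγ 0 (2 * R) (by omega) hn2
    have hu : N ((γ R)⁻¹ * γ 0) = R := by
      rw [(wordDist_psm hS).2.1] at e1
      unfold wordDist at e1
      simpa [hNdef] using e1
    have hv : N ((γ R)⁻¹ * γ (2 * R)) = R := by
      unfold wordDist at e2
      push_cast at e2
      simp only [hNdef]
      rw [e2]; ring
    refine hN.exists_lox hδ1 hu hv hR ?_
    have huv : N (((γ R)⁻¹ * γ 0)⁻¹ * ((γ R)⁻¹ * γ (2 * R))) = 2 * R := by
      rw [show ((γ R)⁻¹ * γ 0)⁻¹ * ((γ R)⁻¹ * γ (2 * R)) = (γ 0)⁻¹ * γ (2 * R) by group]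
      unfold wordDist at e3
      simp only [hNdef]
      rw [e3]
      push_cast
      ring
    unfold np
    rw [hu, hv, huv]
    linarith
  have hκ : 0 ≤ κ := (hN.np_nonneg _ _).trans hx1
  have hlin := hN.lox3 hδ0 hx1 hx2
  have hprod := hN.lox2 hδ0 hx1 hx2
  set c := N x - 2 * κ - 2 * (δ + 1) with hc
  have hc0 : 0 < c := by linarith
  refine ⟨x, c, hc0, fun n => by rw [mul_comm]; exact hlin n, ?_⟩
  have hNx := hN.nonneg x
  set K := 2 * (N x + (κ + 2 * (δ + 1)) + (δ + 1)) with hK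
  have hK0 : 0 ≤ K := by positivity
  obtain ⟨D, hD⟩ := exists_nat_ge (4 * K + 5 * (δ + 1) + 1)
  -- the third direction
  obtain ⟨h, hhD, hhmin⟩ : ∃ h : G, (D : ℝ) ≤ N h ∧ ∀ k : ℤ, N h ≤ N (x ^ k * h) := by
    obtain ⟨g, hg⟩ := hcyc x D
    classical
    have hex : ∃ m : ℕ, ∃ k : ℤ, wordNorm (S : Set G) (x ^ k * g) = m := ⟨_, 0, rfl⟩
    obtain ⟨k, hk⟩ := Nat.find_spec hex
    refine ⟨x ^ k * g, ?_, fun j => ?_⟩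
    · simp only [hNdef]
      exact_mod_cast (hg k).le
    · have := Nat.find_min' hex ⟨j + k, rfl⟩
      simp only [hNdef]
      rw [← mul_assoc, ← zpow_add, hk]
      exact_mod_cast this
  obtain ⟨n, hn⟩ := exists_nat_ge ((4 * K + 5 * (δ + 1) + 1) / c)
  rw [div_le_iff₀ hc0] at hn
  have hxn : 4 * K + 5 * (δ + 1) + 1 ≤ N (x ^ n) := hn.trans (hlin n)
  have t1 := hN.third_dir hprod (h := h) (fun j => by
    have := hhmin (-(j : ℤ)); simpa using this) n
  have t2 := hN.third_dir (x := x⁻¹) (K := κ + 2 * (δ + 1)) (fun m n => by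
    rw [inv_pow, inv_pow, inv_inv, hN.np_comm]
    exact hprod n m) (h := h) (fun j => by
    have := hhmin (j : ℤ); simpa using this) n
  rw [hN.inv, inv_pow] at t2
  refine hN.exp_growth hδ0 hK0 (R := 4 * K + 5 * (δ + 1) + 1) (by linarith)
    (x ^ n)⁻¹ (x ^ n) h (by rwa [hN.inv]) hxn (hD.trans hhD) ?_ ?_ ?_
  · refine (hprod n n).trans ?_
    linarith
  · rw [hN.np_comm]; exact t2
  · rw [hN.np_comm]; exact t1

/-- `(𝒟(G), Δ)` is unbounded: there is a sequence of metric
structures `ρ_n` with `Δ(ρ_n, ρ_1) → ∞`. -/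
theorem metric_structures_unbounded (G : Type*) [Group G]
    (hG : IsHyperbolicGroup G) (hne : NonElementary G) :
    ∃ ρ : ℕ → MetricStructures G,
      Tendsto (fun n => Delta (ρ n) (ρ 1)) atTop atTop := by
  classical
  obtain ⟨S, hS, δ, hδ, hh⟩ := hG
  obtain ⟨x, c, hc, hx, M, hM, hgr⟩ := group_main S hS hδ hh hne
  -- the generating sets
  set T : ℕ → Finset G := fun n => if n = 1 then S else insert (x ^ n) (insert (x ^ n)⁻¹ S)
    with hT
  have hST : ∀ n, S ⊆ T n := by
    intro n
    simp only [hT]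
    split_ifs
    · exact subset_rfl
    · exact (Finset.subset_insert _ _).trans (Finset.subset_insert _ _)
  have hTg : ∀ n, GenSymm ((T n : Finset G) : Set G) := by
    intro n
    refine ⟨fun s hs => ?_, ?_⟩
    · simp only [hT] at hs ⊢
      split_ifs at hs ⊢ with h
      · exact hS.1 s hs
      · simp only [Finset.coe_insert, Set.mem_insert_iff] at hs ⊢
        rcases hs with rfl | rfl | hs
        · simp
        · simp
        · right; right; exact hS.1 s hs
    · refine top_unique ?_
      rw [← hS.2]
      exact Subgroup.closure_mono (by exact_mod_cast hST n)
  have hTc : ∀ n, (T n).card + 1 ≤ S.card + 3 := by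
    intro n
    simp only [hT]
    split_ifs
    · omega
    · have h1 := Finset.card_insert_le (x ^ n) (insert (x ^ n)⁻¹ S)
      have h2 := Finset.card_insert_le (x ^ n)⁻¹ S
      omega
  have hInD : ∀ n, InD (wordDist ((T n : Finset G) : Set G)) := fun n =>
    super_inD S (T n) (hST n) hS (hTg n) hδ hh
  set b : ℝ := Real.log 2 / (M * Real.log ((S.card + 3 : ℕ) : ℝ)) with hb
  have hlogB : 0 < Real.log ((S.card + 3 : ℕ) : ℝ) :=
    Real.log_pos (by push_cast; have : (0 : ℝ) ≤ S.card := Nat.cast_nonneg _; linarith)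
  have hb0 : 0 < b := div_pos (Real.log_pos (by norm_num)) (mul_pos hM hlogB)
  have hT1 : T 1 = S := by simp [hT]
  let ρ : ℕ → MetricStructures G := fun n =>
    Quotient.mk (rsSetoid G) ⟨wordDist ((T n : Finset G) : Set G), hInD n⟩
  refine ⟨ρ, ?_⟩
  have hlow : ∀ n : ℕ, 2 ≤ n → Real.log ((c * b) * n) ≤ Delta (ρ n) (ρ 1) := by
    intro n hn
    have hn0 : (0 : ℝ) < n := by exact_mod_cast (by omega : 0 < n)
    refine Real.log_le_log (by positivity) ?_
    refine le_csInf ⟨_, ⟨wordDist ((T n : Finset G) : Set G), hInD n⟩,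
      ⟨wordDist ((T 1 : Finset G) : Set G), hInD 1⟩, rfl, rfl, rfl⟩ ?_
    rintro _ ⟨d1, d2, h1, h2, rfl⟩
    have r1 : RSim d1.1 (wordDist ((T n : Finset G) : Set G)) := Quotient.exact h1
    have r2 : RSim d2.1 (wordDist ((T 1 : Finset G) : Set G)) := Quotient.exact h2
    rw [hT1] at r2
    obtain ⟨L, hL, hcomp1, hcomp2⟩ := super_compare S (T n) (hST n) hS (hTg n)
    have := lam_lower r1 r2 hL hcomp1 hcomp2 (a := c * n) (b := b) (by positivity) hb0.le
      (fun k => ?_) (fun l A hl hA H => ?_)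
    · calc c * b * n = c * n * b := by ring
        _ ≤ _ := this
    · refine ⟨1, (x ^ n) ^ k, ?_, ?_⟩
      · rw [wordDist_one_left]
        have := wordNorm_le_of_list (S := ((T n : Finset G) : Set G))
          (List.replicate k (x ^ n)) (by
            intro y hy
            rw [List.eq_of_mem_replicate hy]
            have : n ≠ 1 := by omega
            simp [hT, this])
        simp only [List.prod_replicate, List.length_replicate] at this
        exact_mod_cast this
      · rw [wordDist_one_left, ← pow_mul]
        have := hx (n * k)
        push_cast at this
        linarith
    · refine growth_bound (T n) (hTg n) (hTc n) hM hgr hl hA (fun g => ?_)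
      have := H 1 g
      rwa [wordDist_one_left, wordDist_one_left] at this
  refine tendsto_atTop_mono' atTop (eventually_atTop.2 ⟨2, fun n hn => hlow n hn⟩) ?_
  exact Real.tendsto_log_atTop.comp
    (tendsto_natCast_atTop_atTop.const_mul_atTop (mul_pos hc hb0))

end
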